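/- arXiv:2205.04643 — 5 statements merged into one kernel-verified Lean document; each statement's English description precedes it below -/
import Mathlib

section
/- Let P be a finite set of points in the Euclidean plane, let ρ be a natural number, and let S ⊆ P be a nonempty subset of cardinality k such that every point of P is within distance ρ of some point of S. Then P can be point-burned in k + ρ steps. -/
/-- A finite set `P` of points in the Euclidean plane can be point-burned in `b` steps. -/
def PointBurnsIn (P : Finset (EuclideanSpace ℝ (Fin 2))) (b : ℕ) : Prop :=
  ∃ k : ℕ, 1 ≤ k ∧ k ≤ b ∧
    ∃ x : Fin k → EuclideanSpace ℝ (Fin 2),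
      (∀ i, x i ∈ P) ∧
      ∀ p ∈ P, ∃ i : Fin k, dist p (x i) ≤ (b : ℝ) - ((i : ℕ) + 1)

theorem stmt_2 (P S : Finset (EuclideanSpace ℝ (Fin 2))) (ρ k : ℕ)
    (hSP : S ⊆ P) (hS : S.Nonempty) (hk : S.card = k)
    (hcov : ∀ p ∈ P, ∃ s ∈ S, dist p s ≤ (ρ : ℝ)) :
    PointBurnsIn P (k + ρ) := by
  subst hk
  let e := S.equivFin
  refine ⟨S.card, hS.card_pos, Nat.le_add_right _ _, fun i => e.symm i,
    fun i => hSP (e.symm i).2, fun p hp => ?_⟩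
  obtain ⟨s, hs, hps⟩ := hcov p hp
  refine ⟨e ⟨s, hs⟩, ?_⟩
  have hi : (((e ⟨s, hs⟩ : Fin S.card) : ℕ) : ℝ) + 1 ≤ S.card := by
    exact_mod_cast (e ⟨s, hs⟩).isLt
  simp only [Equiv.symm_apply_apply]
  push_cast
  linarith
end

section
/- Let P be a nonempty finite set of points in the Euclidean plane with point burning number δ*, let ε > 0, and let δ be a positive integer with δ ≤ δ*. Suppose D' ⊆ P is a nonempty subset such that every point of P is within distance δ − 1 of some point of D', and |D'| ≤ (1 + ε)·δ. Then P can be point-burned in |D'| + δ − 1 steps, and |D'| + δ − 1 ≤ (2 + ε)·δ*. -/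
theorem stmt_3 (P : Finset (EuclideanSpace ℝ (Fin 2))) (hP : P.Nonempty)
    (δstar : ℕ) (hδstar : IsLeast {b : ℕ | PointBurnsIn P b} δstar)
    (ε : ℝ) (hε : 0 < ε) (δ : ℕ) (hδpos : 0 < δ) (hδle : δ ≤ δstar)
    (D' : Finset (EuclideanSpace ℝ (Fin 2))) (hD'P : D' ⊆ P) (hD' : D'.Nonempty)
    (hcov : ∀ p ∈ P, ∃ s ∈ D', dist p s ≤ (δ : ℝ) - 1)
    (hcard : (D'.card : ℝ) ≤ (1 + ε) * δ) :
    PointBurnsIn P (D'.card + δ - 1) ∧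
      ((D'.card + δ - 1 : ℕ) : ℝ) ≤ (2 + ε) * δstar := by
  have hcardpos : 0 < D'.card := hD'.card_pos
  have hcast : ((D'.card + δ - 1 : ℕ) : ℝ) = D'.card + δ - 1 := by
    rw [Nat.cast_sub (by omega)]
    push_cast
    ring
  refine ⟨⟨D'.card, hcardpos, by omega, fun i => D'.equivFin.symm i,
    fun i => hD'P (D'.equivFin.symm i).2, fun p hp => ?_⟩, ?_⟩
  · obtain ⟨s, hs, hps⟩ := hcov p hp
    refine ⟨D'.equivFin ⟨s, hs⟩, ?_⟩
    have hi : ((D'.equivFin ⟨s, hs⟩ : ℕ) : ℝ) + 1 ≤ D'.card := by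
      exact_mod_cast (D'.equivFin ⟨s, hs⟩).isLt
    simp only [Equiv.symm_apply_apply, hcast]
    linarith
  · have hδ : (δ : ℝ) ≤ δstar := by exact_mod_cast hδle
    have hmul : (2 + ε) * (δ : ℝ) ≤ (2 + ε) * δstar := by gcongr
    rw [hcast]
    linarith
end

section
/- Let P be a nonempty finite set of points in the Euclidean plane with anywhere burning number δ*, let ε > 0, and let δ be a positive integer with δ ≤ δ*.ltSuppose c_1, …, c_m (m ≥ 1) are points in the plane such that every point of P is within distance δ − 1 of some c_i, and m ≤ (1 + ε)·δ. Then P can be anywhere-burned in m + δ − 1 steps, and m + δ − 1 ≤ (2 + ε)·δ*. -/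
/-- A finite set `P` of points in the Euclidean plane can be anywhere-burned in `b` steps. -/
def AnywhereBurnsIn (P : Finset (EuclideanSpace ℝ (Fin 2))) (b : ℕ) : Prop :=
  ∃ k : ℕ, 1 ≤ k ∧ k ≤ b ∧
    ∃ x : Fin k → EuclideanSpace ℝ (Fin 2),
      ∀ p ∈ P, ∃ i : Fin k, dist p (x i) ≤ (b : ℝ) - ((i : ℕ) + 1)

theorem stmt_6 (P : Finset (EuclideanSpace ℝ (Fin 2))) (hP : P.Nonempty)
    (δstar : ℕ) (hδstar : IsLeast {b : ℕ | AnywhereBurnsIn P b} δstar)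
    (ε : ℝ) (hε : 0 < ε) (δ : ℕ) (hδpos : 0 < δ) (hδle : δ ≤ δstar)
    (m : ℕ) (hm : 1 ≤ m) (c : Fin m → EuclideanSpace ℝ (Fin 2))
    (hcov : ∀ p ∈ P, ∃ i : Fin m, dist p (c i) ≤ (δ : ℝ) - 1)
    (hcard : (m : ℝ) ≤ (1 + ε) * δ) :
    AnywhereBurnsIn P (m + δ - 1) ∧
      ((m + δ - 1 : ℕ) : ℝ) ≤ (2 + ε) * δstar := by
  have hb : ((m + δ - 1 : ℕ) : ℝ) = m + δ - 1 := by
    rw [Nat.cast_sub (by omega)]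
    push_cast
    rfl
  refine ⟨⟨m, hm, by omega, c, fun p hp => ?_⟩, ?_⟩
  · obtain ⟨i, hi⟩ := hcov p hp
    refine ⟨i, hi.trans ?_⟩
    have him : ((i : ℕ) : ℝ) + 1 ≤ m := by exact_mod_cast i.isLt
    rw [hb]
    linarith
  · have hle : (δ : ℝ) ≤ δstar := by exact_mod_cast hδle
    rw [hb]
    calc (m : ℝ) + δ - 1 ≤ (2 + ε) * δ := by linarith
      _ ≤ (2 + ε) * δstar := by gcongr
end

section
/- Let S be a nonempty finite set of points in the Euclidean plane contained in the closed ball of radius r ≥ 0 around some point q. Then there exists a point c in the plane such that S is contained in the closed ball of radius r around c, and c either belongs to S, or is the midpoint of two distinct points of S, or is equidistant from three pairwise distinct points of S. -/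
/-- Moving from a point equidistant from `a` and `b` towards their midpoint decreases the distance
to `a`. -/
theorem dist_lineMap_midpoint_lt {E : Type*} [NormedAddCommGroup E] [InnerProductSpace ℝ E]
    {a b c : E} (h : dist a c = dist b c) (hm : midpoint ℝ a b ≠ c) {t : ℝ} (ht : 0 < t)
    (ht1 : t < 1) : dist a (AffineMap.lineMap c (midpoint ℝ a b) t) < dist a c := by
  obtain ⟨u, rfl⟩ : ∃ u, a = u + c := ⟨a - c, by simp⟩
  obtain ⟨w, rfl⟩ : ∃ w, b = w + c := ⟨b - c, by simp⟩
  have hmid : midpoint ℝ (u + c) (w + c) = (2⁻¹ : ℝ) • (u + w) + c := by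
    rw [midpoint_eq_smul_add, invOf_eq_inv]
    module
  rw [hmid] at hm ⊢
  set s := (2⁻¹ : ℝ) • (u + w) with hs
  have hs0 : s ≠ 0 := fun h0 => hm (by simp [h0])
  have huw : ‖u‖ = ‖w‖ := by simpa [dist_eq_norm] using h
  have hus : inner ℝ u s = ‖s‖ ^ 2 := by
    rw [hs, norm_smul, mul_pow, norm_add_sq_real, inner_smul_right, inner_add_right,
      real_inner_self_eq_norm_sq, huw]
    norm_num
    ring
  have hpos : 0 < ‖s‖ ^ 2 := by positivity
  have hsub : u + c - AffineMap.lineMap c (s + c) t = u - t • s := by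
    rw [AffineMap.lineMap_apply_module]
    module
  rw [dist_eq_norm, dist_eq_norm, hsub, add_sub_cancel_right]
  refine lt_of_pow_lt_pow_left₀ 2 (norm_nonneg _) ?_
  clear_value s
  rw [norm_sub_sq_real, inner_smul_right, hus, norm_smul, mul_pow, Real.norm_eq_abs, sq_abs]
  nlinarith [mul_pos (mul_pos ht hpos) (sub_pos.2 ht1), mul_pos ht hpos]

/-- A nonempty finite set in a proper metric space has a smallest enclosing closed ball. -/
theorem Finset.exists_forall_sup'_dist_le {E : Type*} [PseudoMetricSpace E] [ProperSpace E]
    (S : Finset E) (hS : S.Nonempty) :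
    ∃ c : E, ∀ x : E, S.sup' hS (dist · c) ≤ S.sup' hS (dist · x) := by
  obtain ⟨p, hp⟩ := hS
  have : Nonempty E := ⟨p⟩
  refine Continuous.exists_forall_le (f := fun x => S.sup' ⟨p, hp⟩ (dist · x)) ?_ ?_
  · exact Continuous.finset_sup'_apply _ fun i _ => continuous_const.dist continuous_id
  · exact Filter.tendsto_atTop_mono (fun x => Finset.le_sup' (dist · x) hp)
      (tendsto_dist_left_cocompact_atTop p)

open Filter Topology in
/-- The center of a smallest ball enclosing a finite set is a point of the set, the midpoint of two
of its points, or equidistant from three of its points. -/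
theorem Finset.mem_or_eq_midpoint_or_equidistant {E : Type*} [NormedAddCommGroup E]
    [InnerProductSpace ℝ E] (S : Finset E) (hS : S.Nonempty) (c : E)
    (hc : ∀ x : E, S.sup' hS (dist · c) ≤ S.sup' hS (dist · x)) :
    c ∈ S ∨
      (∃ a ∈ S, ∃ b ∈ S, a ≠ b ∧ c = midpoint ℝ a b) ∨
      (∃ a ∈ S, ∃ b ∈ S, ∃ d ∈ S, a ≠ b ∧ b ≠ d ∧ a ≠ d ∧
        dist c a = dist c b ∧ dist c b = dist c d) := by
  classical
  set R := S.sup' hS (dist · c) with hR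
  have hle : ∀ p ∈ S, dist p c ≤ R := fun p hp => Finset.le_sup' (dist · c) hp
  obtain ⟨a, ha, haR⟩ := S.exists_mem_eq_sup' hS (dist · c)
  rw [← hR] at haR
  obtain ⟨b, hb, hbR, hab⟩ | ⟨b, hb, d, hd, hab, hbd, had, hbR, hdR⟩ :
      (∃ b ∈ S, dist b c = R ∧ ∀ p ∈ S, dist p c = R → p = a ∨ p = b) ∨
      ∃ b ∈ S, ∃ d ∈ S, a ≠ b ∧ b ≠ d ∧ a ≠ d ∧ dist b c = R ∧ dist d c = R := by
    by_cases h : ∃ b ∈ S, dist b c = R ∧ a ≠ b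
    · obtain ⟨b, hb, hbR, hab⟩ := h
      by_cases h' : ∃ d ∈ S, dist d c = R ∧ a ≠ d ∧ b ≠ d
      · obtain ⟨d, hd, hdR, had, hbd⟩ := h'
        exact .inr ⟨b, hb, d, hd, hab, hbd, had, hbR, hdR⟩
      · exact .inl ⟨b, hb, hbR, by grind⟩
    · exact .inl ⟨a, ha, haR.symm, by grind⟩
  · by_cases hm : midpoint ℝ a b = c
    · by_cases hne : a = b
      · subst hne
        exact .inl (by simpa [← hm] using ha)
      · exact .inr (.inl ⟨a, ha, b, hb, hne, hm.symm⟩)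
    · have key : ∀ᶠ t in 𝓝[>] (0 : ℝ), ∀ p ∈ S,
          dist p (AffineMap.lineMap c (midpoint ℝ a b) t) < R := by
        rw [Filter.eventually_all_finset]
        intro p hp
        rcases (hle p hp).lt_or_eq with hlt | heq
        · have hcont : Continuous fun t : ℝ =>
              dist p (AffineMap.lineMap c (midpoint ℝ a b) t) :=
            continuous_const.dist AffineMap.lineMap_continuous
          exact (hcont.continuousAt.eventually_lt continuousAt_const (by simpa using hlt)).filter_mono
            nhdsWithin_le_nhds
        · filter_upwards [Ioo_mem_nhdsGT (zero_lt_one' ℝ)] with t ht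
          rw [← heq]
          rcases hab p hp heq with rfl | rfl
          · exact dist_lineMap_midpoint_lt (heq.trans hbR.symm) hm ht.1 ht.2
          · rw [midpoint_comm] at hm ⊢
            exact dist_lineMap_midpoint_lt (heq.trans haR) hm ht.1 ht.2
      obtain ⟨t, ht⟩ := key.exists
      exact absurd (hc _) (not_le.2 ((Finset.sup'_lt_iff hS).2 ht))
  · refine .inr (.inr ⟨a, ha, b, hb, d, hd, hab, hbd, had, ?_, ?_⟩)
    · rw [dist_comm c a, dist_comm c b, hbR, haR]
    · rw [dist_comm c b, dist_comm c d, hbR, hdR]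

theorem stmt_8 (S : Finset (EuclideanSpace ℝ (Fin 2))) (hS : S.Nonempty)
    (r : ℝ) (hr : 0 ≤ r) (q : EuclideanSpace ℝ (Fin 2))
    (hq : ∀ p ∈ S, dist p q ≤ r) :
    ∃ c : EuclideanSpace ℝ (Fin 2),
      (∀ p ∈ S, dist p c ≤ r) ∧
      (c ∈ S ∨
        (∃ a ∈ S, ∃ b ∈ S, a ≠ b ∧ c = midpoint ℝ a b) ∨
        (∃ a ∈ S, ∃ b ∈ S, ∃ d ∈ S, a ≠ b ∧ b ≠ d ∧ a ≠ d ∧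
          dist c a = dist c b ∧ dist c b = dist c d)) := by
  obtain ⟨c, hc⟩ := S.exists_forall_sup'_dist_le hS
  exact ⟨c, fun p hp => (Finset.le_sup' (dist · c) hp).trans
    ((hc q).trans (Finset.sup'_le hS _ hq)), S.mem_or_eq_midpoint_or_equidistant hS c hc⟩
end

section
/- Let P be a finite set of points in the Euclidean plane that can be anywhere-burned in b steps, and let Q ⊆ P be a subset whose points are pairwise at distance strictly greater than 2(b − 1). Then |Q| ≤ b. -/
theorem stmt_12 (P Q : Finset (EuclideanSpace ℝ (Fin 2))) (b : ℕ)
    (hb : AnywhereBurnsIn P b) (hQP : Q ⊆ P)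
    (hsep : ∀ a ∈ Q, ∀ a' ∈ Q, a ≠ a' → 2 * ((b : ℝ) - 1) < dist a a') :
    Q.card ≤ b := by
  obtain ⟨k, -, hkb, x, hx⟩ := hb
  choose f hf using fun q : Q => hx q (hQP q.2)
  have hinj : Function.Injective f := by
    intro p q hpq
    by_contra hne
    have hlt := hsep p p.2 q q.2 fun h => hne (Subtype.ext h)
    have hp := hf p
    have hq := hf q
    rw [← hpq] at hq
    have htri := dist_triangle_right (p : EuclideanSpace ℝ (Fin 2)) q (x (f p))
    have hnonneg : (0 : ℝ) ≤ ((f p : ℕ) : ℝ) := Nat.cast_nonneg _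
    linarith
  have hcard := Fintype.card_le_of_injective f hinj
  rw [Fintype.card_coe, Fintype.card_fin] at hcard
  exact hcard.trans hkb
end
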